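/- arXiv:2409.11998 — 3 statements merged into one kernel-verified Lean document; each statement's English description precedes it below -/
import Mathlib

section
/- Let h : ℝ → ℝ be smooth with h(0) = 0 and h'(0) = 0 (a boundary curve given locally as the graph x₂ = h(x₁), tangent to the horizontal axis at the origin, with curvature κ = h''(0) at the origin), and let σ : ℝ → ℝ be smooth with compact support. For δ > 0, define the on-surface local single layer heat potential at the origin by S_L(δ) = ∫_0^δ ∫_ℝ exp(-(ξ² + h(ξ)²)/(4t))/(4πt) · σ(ξ)·√(1 + h'(ξ)²) dξ dt. Then there exist constants C > 0 and δ₀ > 0 such that for all 0 < δ ≤ δ₀, | S_L(δ) - √δ·σ(0)/√π - δ^{3/2}·(1/(3√π))·( h''(0)²·σ(0)/4 + σ''(0) ) | ≤ C·δ^{5/2}. -/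
open MeasureTheory

theorem taylor_bd (n : ℕ) (R : ℝ) (hR : 0 ≤ R) : ∀ (f : ℝ → ℝ) (hf : ContDiff ℝ (⊤ : ℕ∞) f),
    ∃ C : ℝ, 0 ≤ C ∧ ∀ x, |x| ≤ R →
      |f x - ∑ k ∈ Finset.range n, iteratedDeriv k f 0 / (k.factorial : ℝ) * x ^ k| ≤ C * |x| ^ n := by
  induction n with
  | zero =>
    intro f hf
    obtain ⟨C, hC⟩ := (isCompact_Icc (a := -R) (b := R)).exists_bound_of_continuousOn hf.continuous.continuousOn
    refine ⟨C, (norm_nonneg _).trans (hC 0 ⟨by linarith, hR⟩), fun x hx => ?_⟩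
    simpa using hC x (abs_le.mp hx)
  | succ n ih =>
    intro f hf
    have hf' : ContDiff ℝ (⊤ : ℕ∞) (deriv f) := (contDiff_infty_iff_deriv.mp hf).2
    have hd : Differentiable ℝ f := (contDiff_infty_iff_deriv.mp hf).1
    obtain ⟨C, hC0, hC⟩ := ih (deriv f) hf'
    refine ⟨C, hC0, fun x hx => ?_⟩
    set F : ℝ → ℝ := fun x => f x - ∑ k ∈ Finset.range (n+1), iteratedDeriv k f 0 / (k.factorial : ℝ) * x ^ k with hF
    have hder : ∀ y, HasDerivAt F (deriv f y - ∑ k ∈ Finset.range n, iteratedDeriv k (deriv f) 0 / (k.factorial : ℝ) * y ^ k) y := by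
      intro y
      have h1 : HasDerivAt (fun y : ℝ => ∑ k ∈ Finset.range (n+1), iteratedDeriv k f 0 / (k.factorial : ℝ) * y ^ k)
        (∑ k ∈ Finset.range (n+1), iteratedDeriv k f 0 / (k.factorial : ℝ) * ((k:ℝ) * y ^ (k-1))) y := by
        apply HasDerivAt.fun_sum
        intro k _
        exact (hasDerivAt_pow k y).const_mul _
      have h2 := (hd y).hasDerivAt.sub h1
      refine h2.congr_deriv ?_
      symm
      congr 1
      rw [Finset.sum_range_succ']
      simp only [iteratedDeriv_succ', Nat.factorial_succ]
      simp
      apply Finset.sum_congr rfl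
      intro k _
      have := Nat.factorial_ne_zero k
      field_simp
    have key := Convex.norm_image_sub_le_of_norm_hasDerivWithin_le (f := F) (s := Set.Icc (-|x|) |x|) (x := 0) (y := x) (C := C * |x|^n)
      (fun y _ => (hder y).hasDerivWithinAt) (fun y hy => by
        have hy' := abs_le.mpr hy
        refine (hC y (hy'.trans hx)).trans ?_
        gcongr) (convex_Icc _ _) ⟨by simp, by simp⟩ ⟨neg_abs_le x, le_abs_self x⟩
    have hF0 : F 0 = 0 := by
      simp [hF, Finset.sum_range_succ']
    rw [hF0, sub_zero, sub_zero] at key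
    calc _ = ‖F x‖ := rfl
      _ ≤ _ := key
      _ = _ := by rw [Real.norm_eq_abs, pow_succ, mul_assoc]

theorem gm_int (a : ℝ) (ha : 0 < a) (n : ℕ) : Integrable (fun x : ℝ => Real.exp (-a * x^2) * x ^ n) := by
  have := integrable_rpow_mul_exp_neg_mul_sq ha (s := (n:ℝ)) (by have := Nat.cast_nonneg (α := ℝ) n; linarith)
  simp only [Real.rpow_natCast] at this
  simpa [mul_comm] using this

theorem gm_one (a : ℝ) (ha : 0 < a) : ∫ x : ℝ, Real.exp (-a * x^2) * x ^ 1 = 0 := by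
  have hd : ∀ x : ℝ, HasDerivAt (fun x : ℝ => Real.exp (-a * x^2)) ((-2*a) * (Real.exp (-a * x^2) * x ^ 1)) x := by
    intro x
    have := (((hasDerivAt_pow 2 x).const_mul (-a)).exp)
    convert this using 1
    norm_num; ring
  have := integral_eq_zero_of_hasDerivAt_of_integrable hd ((gm_int a ha 1).const_mul _) (by simpa using gm_int a ha 0)
  rw [integral_const_mul] at this
  have h2 : -2 * a ≠ 0 := by nlinarith
  exact (mul_eq_zero.mp this).resolve_left h2

theorem gm_rec (a : ℝ) (ha : 0 < a) (n : ℕ) : ∫ x : ℝ, Real.exp (-a * x^2) * x ^ (n+2) = (n+1)/(2*a) * ∫ x : ℝ, Real.exp (-a * x^2) * x ^ n := by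
  have hd : ∀ x : ℝ, HasDerivAt (fun x : ℝ => Real.exp (-a * x^2) * x^(n+1)) ((-2*a) * (Real.exp (-a * x^2) * x ^ (n+2)) + (n+1) * (Real.exp (-a * x^2) * x ^ n)) x := by
    intro x
    have := (((hasDerivAt_pow 2 x).const_mul (-a)).exp).mul (hasDerivAt_pow (n+1) x)
    refine this.congr_deriv ?_
    push_cast
    simp only [pow_succ]
    ring
  have := integral_eq_zero_of_hasDerivAt_of_integrable hd (((gm_int a ha (n+2)).const_mul _).add ((gm_int a ha n).const_mul _)) (gm_int a ha (n+1))
  rw [integral_add ((gm_int a ha (n+2)).const_mul _) ((gm_int a ha n).const_mul _), integral_const_mul, integral_const_mul] at this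
  have ha' : a ≠ 0 := ha.ne'
  generalize (∫ x : ℝ, Real.exp (-a * x^2) * x ^ (n+2)) = A at *
  generalize (∫ x : ℝ, Real.exp (-a * x^2) * x ^ n) = B at *
  field_simp
  linarith

theorem gm_zero (a : ℝ) : ∫ x : ℝ, Real.exp (-a * x^2) * x ^ 0 = Real.sqrt (Real.pi / a) := by
  simpa using integral_gaussian a

theorem exp_bd (u : ℝ) (hu : 0 ≤ u) : |Real.exp (-u) - 1 + u| ≤ u^2 := by
  have h1 := Real.add_one_le_exp (-u)
  rw [abs_of_nonneg (by linarith)]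
  have h2 := Real.add_one_le_exp u
  have h3 : Real.exp (-u) * Real.exp u = 1 := by rw [← Real.exp_add]; simp
  have h4 := Real.exp_pos (-u)
  have h5 : Real.exp (-u) * (1 + u) ≤ 1 := by nlinarith
  have h6 : Real.exp (-u) ≤ 1 := by nlinarith
  nlinarith

theorem pw_in (C0 C1 C2 C3 C4 R p2 p3 g0 g1 g2 g3 : ℝ)
    (hC0 : 0 ≤ C0) (hC1 : 0 ≤ C1) (hC2 : 0 ≤ C2) (hC3 : 0 ≤ C3) (hC4 : 0 ≤ C4) (hR : 0 ≤ R) :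
    ∃ C : ℝ, 0 ≤ C ∧ ∀ s > (0:ℝ), ∀ x H G : ℝ, |x| ≤ R → |H| ≤ C0 * |x|^2 →
      |H - (p2 * x^2 + p3 * x^3)| ≤ C1 * |x|^4 → |G| ≤ C2 → |G - (g0 + g1 * x)| ≤ C3 * |x|^2 →
      |G - (g0 + g1 * x + g2 * x^2 + g3 * x^3)| ≤ C4 * |x|^4 →
      |Real.exp (-s * H^2) * G - (g0 + g1 * x + g2 * x^2 + g3 * x^3 - s * p2^2 * g0 * x^4
        - s * (2 * p2 * p3 * g0 + p2^2 * g1) * x^5)| ≤ C * (x^4 + s * x^6 + s^2 * x^8) := by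
  set K1 := C0^4 * C2
  set K3 := C0^2 * C3
  set K4 := (C1 * (C0 + |p2| + |p3| * R) + |p3|^2) * (|g0| + |g1| * R)
  set K5 := |2 * p2 * p3 * g1|
  have hK1 : 0 ≤ K1 := by positivity
  have hK3 : 0 ≤ K3 := by positivity
  have hK4 : 0 ≤ K4 := by positivity
  have hK5 : 0 ≤ K5 := by positivity
  refine ⟨K1 + C4 + K3 + K4 + K5, by positivity, fun s hs x H G hx hH hH1 hG hG1 hG2 => ?_⟩
  have e1 : |(Real.exp (-(s * H^2)) - 1 + s * H^2) * G| ≤ K1 * (s^2 * |x|^8) := by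
    rw [abs_mul]
    calc _ ≤ (s * H^2)^2 * C2 := mul_le_mul (exp_bd _ (by positivity)) hG (abs_nonneg _) (by positivity)
      _ = (s^2 * |H|^4) * C2 := by rw [show |H|^4 = (|H|^2)^2 by ring, sq_abs]; ring
      _ ≤ (s^2 * (C0 * |x|^2)^4) * C2 := by gcongr
      _ = _ := by ring
  have e3 : |s * H^2 * (G - (g0 + g1 * x))| ≤ K3 * (s * |x|^6) := by
    rw [abs_mul, abs_mul, abs_of_pos hs, abs_pow]
    calc _ ≤ s * (C0 * |x|^2)^2 * (C3 * |x|^2) := by gcongr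
      _ = _ := by ring
  have e4 : |s * (H^2 - (p2^2*x^4 + 2*p2*p3*x^5)) * (g0 + g1 * x)| ≤ K4 * (s * |x|^6) := by
    rw [abs_mul, abs_mul, abs_of_pos hs]
    have f1 : |H^2 - (p2^2*x^4 + 2*p2*p3*x^5)| ≤ (C1 * (C0 + |p2| + |p3| * R) + |p3|^2) * |x|^6 := by
      have : H^2 - (p2^2*x^4 + 2*p2*p3*x^5) = (H - (p2 * x^2 + p3 * x^3)) * (H + (p2 * x^2 + p3 * x^3)) + p3^2 * x^6 := by ring
      rw [this]
      have f2 : |H + (p2 * x^2 + p3 * x^3)| ≤ (C0 + |p2| + |p3| * R) * |x|^2 := by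
        calc _ ≤ |H| + (|p2 * x^2| + |p3*x^3|) := (abs_add_le _ _).trans (by gcongr; exact abs_add_le _ _)
          _ = |H| + (|p2| * |x|^2 + |p3| * |x| * |x|^2) := by simp only [abs_mul, abs_pow]; ring
          _ ≤ C0 * |x|^2 + (|p2| * |x|^2 + |p3| * R * |x|^2) := by gcongr
          _ = _ := by ring
      calc _ ≤ |(H - (p2 * x^2 + p3 * x^3))| * |(H + (p2 * x^2 + p3 * x^3))| + |p3|^2 * |x|^6 := by
            refine (abs_add_le _ _).trans ?_
            simp only [abs_mul, abs_pow]; rfl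
        _ ≤ (C1 * |x|^4) * ((C0 + |p2| + |p3| * R) * |x|^2) + |p3|^2 * |x|^6 := by gcongr
        _ = _ := by ring
    have f3 : |g0 + g1 * x| ≤ |g0| + |g1| * R := by
      refine (abs_add_le _ _).trans ?_
      rw [abs_mul]; gcongr
    calc _ ≤ s * ((C1 * (C0 + |p2| + |p3| * R) + |p3|^2) * |x|^6) * (|g0| + |g1| * R) := by gcongr
      _ = _ := by ring
  have e5 : |s * (2 * p2 * p3 * g1) * x^6| ≤ K5 * (s * |x|^6) := by
    rw [abs_mul, abs_mul, abs_of_pos hs, abs_pow]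
    apply le_of_eq; ring
  have x4 : |x|^4 = x^4 := by rw [← abs_pow]; exact abs_of_nonneg (by positivity)
  have x6 : |x|^6 = x^6 := by rw [← abs_pow]; exact abs_of_nonneg (by positivity)
  have x8 : |x|^8 = x^8 := by rw [← abs_pow]; exact abs_of_nonneg (by positivity)
  rw [x8] at e1
  rw [x4] at hG2
  rw [x6] at e3 e4 e5
  have hp4 : 0 ≤ x^4 := by positivity
  have hp6 : 0 ≤ s * x^6 := by positivity
  have hp8 : 0 ≤ s^2 * x^8 := by positivity
  have hid : Real.exp (-s * H^2) * G - (g0 + g1 * x + g2 * x^2 + g3 * x^3 - s * p2^2 * g0 * x^4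
        - s * (2 * p2 * p3 * g0 + p2^2 * g1) * x^5) =
      (Real.exp (-(s * H^2)) - 1 + s * H^2) * G + (G - (g0 + g1 * x + g2 * x^2 + g3 * x^3))
      - s * H^2 * (G - (g0 + g1 * x)) - s * (H^2 - (p2^2*x^4 + 2*p2*p3*x^5)) * (g0 + g1 * x)
      - s * (2 * p2 * p3 * g1) * x^6 := by
    rw [show -s * H^2 = -(s * H^2) by ring]; ring
  rw [hid]
  calc _ ≤ K1 * (s^2 * x^8) + C4 * x^4 + K3 * (s * x^6) + K4 * (s * x^6) + K5 * (s * x^6) := by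
        rw [abs_le] at *
        constructor <;> linarith [e1.1, e1.2, e3.1, e3.2, e4.1, e4.2, e5.1, e5.2, hG2.1, hG2.2]
    _ ≤ (K1 + C4 + K3 + K4 + K5) * (x^4 + s * x^6 + s^2 * x^8) := by
        generalize x^4 = X4 at *
        generalize s * x^6 = X6 at *
        generalize s^2 * x^8 = X8 at *
        have : 0 ≤ K1 * (X4 + X6) + C4 * (X6 + X8) + (K3 + K4 + K5) * (X4 + X8) := by positivity
        linarith

theorem pw_out (g0 g1 g2 g3 p q : ℝ) :
    ∃ C : ℝ, 0 ≤ C ∧ ∀ s > (0:ℝ), ∀ x : ℝ, 1 ≤ |x| →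
      |g0 + g1 * x + g2 * x^2 + g3 * x^3 - s * p * x^4 - s * q * x^5| ≤ C * (x^4 + s * x^6 + s^2 * x^8) := by
  refine ⟨|g0| + |g1| + |g2| + |g3| + |p| + |q|, by positivity, fun s hs x hx => ?_⟩
  have x4 : |x|^4 = x^4 := by rw [← abs_pow]; exact abs_of_nonneg (by positivity)
  have x6 : |x|^6 = x^6 := by rw [← abs_pow]; exact abs_of_nonneg (by positivity)
  have a0 : |g0| ≤ |g0| * x^4 := by rw [← x4]; exact le_mul_of_one_le_right (abs_nonneg _) (one_le_pow₀ hx)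
  have a1 : |g1 * x| ≤ |g1| * x^4 := by
    rw [← x4, abs_mul]; gcongr; exact le_self_pow₀ hx (by norm_num)
  have a2 : |g2 * x^2| ≤ |g2| * x^4 := by
    rw [← x4, abs_mul, abs_pow]; gcongr; norm_num
  have a3 : |g3 * x^3| ≤ |g3| * x^4 := by
    rw [← x4, abs_mul, abs_pow]; gcongr; norm_num
  have a4 : |s * p * x^4| ≤ |p| * (s * x^6) := by
    rw [← x6, abs_mul, abs_mul, abs_pow, abs_of_pos hs]
    calc _ ≤ s * |p| * |x|^6 := by gcongr; norm_num
      _ = _ := by ring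
  have a5 : |s * q * x^5| ≤ |q| * (s * x^6) := by
    rw [← x6, abs_mul, abs_mul, abs_pow, abs_of_pos hs]
    calc _ ≤ s * |q| * |x|^6 := by gcongr; norm_num
      _ = _ := by ring
  have hp4 : 0 ≤ x^4 := by positivity
  have hp6 : 0 ≤ s * x^6 := by positivity
  have hp8 : 0 ≤ s^2 * x^8 := by positivity
  calc _ ≤ (|g0| + |g1| + |g2| + |g3|) * x^4 + (|p| + |q|) * (s * x^6) := by
        have b0 := abs_le.mp a0
        have b1 := abs_le.mp a1
        have b2 := abs_le.mp a2
        have b3 := abs_le.mp a3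
        have b4 := abs_le.mp a4
        have b5 := abs_le.mp a5
        rw [abs_le]
        constructor <;> linarith [b0.1, b0.2, b1.1, b1.2, b2.1, b2.2, b3.1, b3.2, b4.1, b4.2, b5.1, b5.2, neg_abs_le g0, le_abs_self g0]
    _ ≤ _ := by
        generalize x^4 = X4 at *
        generalize s * x^6 = X6 at *
        generalize s^2 * x^8 = X8 at *
        have : 0 ≤ (|g0| + |g1| + |g2| + |g3|) * (X6 + X8) + (|p| + |q|) * (X4 + X8) := by positivity
        linarith

theorem pw (h g : ℝ → ℝ) (hh : ContDiff ℝ (⊤ : ℕ∞) h) (h0 : h 0 = 0) (h0' : deriv h 0 = 0)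
    (hg : ContDiff ℝ (⊤ : ℕ∞) g) (hgc : HasCompactSupport g) :
    ∃ C g1 g3 q : ℝ, 0 ≤ C ∧ ∀ s > (0:ℝ), ∀ x : ℝ,
      |Real.exp (-s * (h x)^2) * g x - (g 0 + g1 * x + deriv (deriv g) 0 / 2 * x^2 + g3 * x^3
        - s * ((deriv (deriv h) 0 / 2)^2 * g 0) * x^4 - s * q * x^5)|
        ≤ C * (x^4 + s * x^6 + s^2 * x^8) := by
  obtain ⟨R, hR1, hR⟩ : ∃ R : ℝ, 1 ≤ R ∧ ∀ x, R < |x| → g x = 0 := by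
    obtain ⟨R, hR⟩ := hgc.isCompact.isBounded.subset_closedBall 0
    refine ⟨max R 1, le_max_right _ _, fun x hx => ?_⟩
    by_contra hne
    have := hR (subset_tsupport g hne)
    simp at this
    exact absurd (this.trans (le_max_left R 1)) (not_le.mpr hx)
  have hR0 : 0 ≤ R := by linarith
  obtain ⟨C0, hC0, H0⟩ := taylor_bd 2 R hR0 h hh
  obtain ⟨C1, hC1, H1⟩ := taylor_bd 4 R hR0 h hh
  obtain ⟨C2, hC2, H2⟩ := taylor_bd 0 R hR0 g hg
  obtain ⟨C3, hC3, H3⟩ := taylor_bd 2 R hR0 g hg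
  obtain ⟨C4, hC4, H4⟩ := taylor_bd 4 R hR0 g hg
  simp only [Finset.sum_range_succ, Finset.sum_range_zero, iteratedDeriv_succ, iteratedDeriv_zero, h0, h0',
    Nat.factorial] at H0 H1 H2 H3 H4
  norm_num at H0 H1 H2 H3 H4
  set p2 := deriv (deriv h) 0 / 2
  set p3 := deriv (deriv (deriv h)) 0 / 6
  set g1 := deriv g 0
  set g2 := deriv (deriv g) 0 / 2
  set g3 := deriv (deriv (deriv g)) 0 / 6
  obtain ⟨Ci, hCi, Hi⟩ := pw_in C0 C1 C2 C3 C4 R p2 p3 (g 0) g1 g2 g3 hC0 hC1 hC2 hC3 hC4 hR0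
  obtain ⟨Co, hCo, Ho⟩ := pw_out (g 0) g1 g2 g3 (p2^2 * g 0) (2 * p2 * p3 * g 0 + p2^2 * g1)
  refine ⟨max Ci Co, g1, g3, (2 * p2 * p3 * g 0 + p2^2 * g1), le_max_of_le_left hCi, fun s hs x => ?_⟩
  have hpos : 0 ≤ x^4 + s * x^6 + s^2 * x^8 := by positivity
  rcases le_or_gt |x| R with hx | hx
  · refine le_trans ?_ (mul_le_mul_of_nonneg_right (le_max_left _ _) hpos)
    have := Hi s hs x (h x) (g x) hx (by simpa using H0 x hx) (by simpa using H1 x hx) (H2 x hx) (by simpa using H3 x hx) (by simpa using H4 x hx)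
    simpa only [mul_assoc] using this
  · refine le_trans ?_ (mul_le_mul_of_nonneg_right (le_max_right _ _) hpos)
    have := Ho s hs x (by linarith)
    rw [hR x hx, mul_zero, zero_sub, abs_neg]
    exact this

theorem gm_vals (s : ℝ) (hs : 0 < s) :
    (∫ x : ℝ, Real.exp (-s * x^2) * x^2 = 1/(2*s) * Real.sqrt (Real.pi / s)) ∧
    (∫ x : ℝ, Real.exp (-s * x^2) * x^3 = 0) ∧
    (∫ x : ℝ, Real.exp (-s * x^2) * x^4 = 3/(4*s^2) * Real.sqrt (Real.pi / s)) ∧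
    (∫ x : ℝ, Real.exp (-s * x^2) * x^5 = 0) ∧
    (∫ x : ℝ, Real.exp (-s * x^2) * x^6 = 15/(8*s^3) * Real.sqrt (Real.pi / s)) ∧
    (∫ x : ℝ, Real.exp (-s * x^2) * x^8 = 105/(16*s^4) * Real.sqrt (Real.pi / s)) := by
  have r := gm_rec s hs
  have m2 := r 0
  have m3 := r 1
  have m4 := r 2
  have m5 := r 3
  have m6 := r 4
  have m8 := r 6
  norm_num only at m2 m3 m4 m5 m6 m8
  rw [gm_zero] at m2
  rw [gm_one s hs] at m3
  rw [m2] at m4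
  rw [m3] at m5
  rw [m4] at m6
  rw [m6] at m8
  refine ⟨?_, ?_, ?_, ?_, ?_, ?_⟩
  · rw [m2]
  · rw [m3]; simp
  · rw [m4]; push_cast; field_simp; try norm_num
  · rw [m5]; simp
  · rw [m6]; push_cast; field_simp; try norm_num
  · rw [m8]; push_cast; field_simp; try norm_num

theorem inner_bd (h g : ℝ → ℝ) (hh : ContDiff ℝ (⊤ : ℕ∞) h) (h0 : h 0 = 0) (h0' : deriv h 0 = 0)
    (hg : ContDiff ℝ (⊤ : ℕ∞) g) (hgc : HasCompactSupport g) :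
    ∃ C : ℝ, 0 ≤ C ∧ ∀ s > (0:ℝ),
      |(∫ x : ℝ, Real.exp (-s * (x^2 + (h x)^2)) * g x) -
        Real.sqrt (Real.pi / s) * (g 0 + (deriv (deriv g) 0 / 4 - 3 * (deriv (deriv h) 0)^2 * g 0 / 16) / s)|
        ≤ C * Real.sqrt (Real.pi / s) / s^2 := by
  obtain ⟨C, g1, g3, q, hC, H⟩ := pw h g hh h0 h0' hg hgc
  refine ⟨C * (3/4 + 15/8 + 105/16), by positivity, fun s hs => ?_⟩
  obtain ⟨m2, m3, m4, m5, m6, m8⟩ := gm_vals s hs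
  have m0 := gm_zero s
  have m1 := gm_one s hs
  have I := gm_int s hs
  set M : ℝ := Real.sqrt (Real.pi / s)
  set g2 := deriv (deriv g) 0 / 2
  set p := (deriv (deriv h) 0 / 2)^2 * g 0
  let P : ℝ → ℝ := fun x => Real.exp (-s * x^2) * (g 0 + g1 * x + g2 * x^2 + g3 * x^3 - s * p * x^4 - s * q * x^5)
  let B : ℝ → ℝ := fun x => Real.exp (-s * x^2) * (C * (x^4 + s * x^6 + s^2 * x^8))
  have hP : P = fun x => g 0 * (Real.exp (-s * x^2) * x^0) + g1 * (Real.exp (-s * x^2) * x^1)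
      + g2 * (Real.exp (-s * x^2) * x^2) + g3 * (Real.exp (-s * x^2) * x^3) + (-s * p) * (Real.exp (-s * x^2) * x^4)
      + (-s * q) * (Real.exp (-s * x^2) * x^5) := by
    funext x; simp only [P]; ring
  have hB : B = fun x => C * (Real.exp (-s * x^2) * x^4) + (C * s) * (Real.exp (-s * x^2) * x^6)
      + (C * s^2) * (Real.exp (-s * x^2) * x^8) := by
    funext x; simp only [B]; ring
  have c0 := (I 0).const_mul (g 0)
  have c1 := c0.add ((I 1).const_mul g1)
  have c2 := c1.add ((I 2).const_mul g2)
  have c3 := c2.add ((I 3).const_mul g3)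
  have c4 := c3.add ((I 4).const_mul (-s * p))
  have c5 := c4.add ((I 5).const_mul (-s * q))
  have d0 := (I 4).const_mul C
  have d1 := d0.add ((I 6).const_mul (C * s))
  have d2 := d1.add ((I 8).const_mul (C * s^2))
  simp only [Pi.add_def] at c1 c2 c3 c4 c5 d1 d2
  have iP : Integrable P := by rw [hP]; exact c5
  have iB : Integrable B := by rw [hB]; exact d2
  have vP : ∫ x, P x = M * (g 0 + (deriv (deriv g) 0 / 4 - 3 * (deriv (deriv h) 0)^2 * g 0 / 16) / s) := by
    rw [hP]
    rw [integral_add c4 ((I 5).const_mul _), integral_add c3 ((I 4).const_mul _), integral_add c2 ((I 3).const_mul _),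
      integral_add c1 ((I 2).const_mul _), integral_add c0 ((I 1).const_mul _)]
    simp only [integral_const_mul]
    rw [m0, m1, m2, m3, m4, m5]
    simp only [p, g2]
    field_simp
    ring
  have vB : ∫ x, B x = C * (3/4 + 15/8 + 105/16) * M / s^2 := by
    rw [hB]
    rw [integral_add d1 ((I 8).const_mul _), integral_add d0 ((I 6).const_mul _)]
    simp only [integral_const_mul]
    rw [m4, m6, m8]
    field_simp
  have hsplit : ∀ x, Real.exp (-s * (x^2 + (h x)^2)) = Real.exp (-s * x^2) * Real.exp (-s * (h x)^2) := by
    intro x; rw [← Real.exp_add]; ring_nf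
  have hch := hh.continuous
  have hcg := hg.continuous
  have iF : Integrable (fun x => Real.exp (-s * (x^2 + (h x)^2)) * g x) := by
    apply Continuous.integrable_of_hasCompactSupport
    · fun_prop
    · exact hgc.mul_left
  rw [← vP, ← vB, ← integral_sub iF iP, ← Real.norm_eq_abs]
  apply norm_integral_le_of_norm_le iB
  filter_upwards with x
  rw [hsplit, Real.norm_eq_abs]
  simp only [P, B]
  rw [mul_assoc, ← mul_sub, abs_mul, abs_of_pos (Real.exp_pos _)]
  exact mul_le_mul_of_nonneg_left (H s hs x) (Real.exp_pos _).le

theorem weight (h σ : ℝ → ℝ) (hh : ContDiff ℝ (⊤ : ℕ∞) h) (h0' : deriv h 0 = 0)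
    (hσ : ContDiff ℝ (⊤ : ℕ∞) σ) :
    ContDiff ℝ (⊤ : ℕ∞) (fun x => σ x * Real.sqrt (1 + (deriv h x)^2)) ∧
    deriv (deriv (fun x => σ x * Real.sqrt (1 + (deriv h x)^2))) 0 = deriv (deriv σ) 0 + (deriv (deriv h) 0)^2 * σ 0 := by
  have hh1 : ContDiff ℝ (⊤ : ℕ∞) (deriv h) := (contDiff_infty_iff_deriv.mp hh).2
  have hh2 : ContDiff ℝ (⊤ : ℕ∞) (deriv (deriv h)) := (contDiff_infty_iff_deriv.mp hh1).2
  have hσ1 : ContDiff ℝ (⊤ : ℕ∞) (deriv σ) := (contDiff_infty_iff_deriv.mp hσ).2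
  have hpos : ∀ x, 1 + (deriv h x)^2 ≠ 0 := fun x => by positivity
  have hw : ContDiff ℝ (⊤ : ℕ∞) (fun x => Real.sqrt (1 + (deriv h x)^2)) :=
    (contDiff_const.add (hh1.pow 2)).sqrt hpos
  refine ⟨hσ.mul hw, ?_⟩
  set w : ℝ → ℝ := fun x => Real.sqrt (1 + (deriv h x)^2) with hwdef
  have w0 : w 0 = 1 := by simp [w, h0']
  have wne : ∀ x, w x ≠ 0 := fun x => (Real.sqrt_pos.mpr (by positivity)).ne'
  have dh : ∀ x, HasDerivAt (deriv h) (deriv (deriv h) x) x := fun x =>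
    ((contDiff_infty_iff_deriv.mp hh1).1 x).hasDerivAt
  have dh2 : ∀ x, HasDerivAt (deriv (deriv h)) (deriv (deriv (deriv h)) x) x := fun x =>
    ((contDiff_infty_iff_deriv.mp hh2).1 x).hasDerivAt
  have ds : ∀ x, HasDerivAt σ (deriv σ x) x := fun x =>
    ((contDiff_infty_iff_deriv.mp hσ).1 x).hasDerivAt
  have ds1 : ∀ x, HasDerivAt (deriv σ) (deriv (deriv σ) x) x := fun x =>
    ((contDiff_infty_iff_deriv.mp hσ1).1 x).hasDerivAt
  have dw : ∀ x, HasDerivAt w (deriv h x * (deriv (deriv h) x / w x)) x := by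
    intro x
    have := (((dh x).pow 2).const_add 1).sqrt (hpos x)
    refine this.congr_deriv ?_
    have := wne x
    simp only [hwdef] at this ⊢
    push_cast
    simp only [Pi.pow_apply]
    field_simp
    try ring
  have d1 : deriv (fun x => σ x * w x) = fun x => deriv σ x * w x + σ x * (deriv h x * (deriv (deriv h) x / w x)) := by
    funext x; exact ((ds x).mul (dw x)).deriv
  rw [show (fun x => σ x * Real.sqrt (1 + (deriv h x)^2)) = fun x => σ x * w x from rfl, d1]
  have := ((ds1 0).mul (dw 0)).add ((ds 0).mul ((dh 0).mul ((dh2 0).div (dw 0) (wne 0))))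
  refine this.deriv.trans ?_
  simp [h0', w0]
  ring

theorem local_single_layer_on_surface_asymptotics
    (h : ℝ → ℝ) (hh : ContDiff ℝ (⊤ : ℕ∞) h) (h0 : h 0 = 0) (h0' : deriv h 0 = 0)
    (σ : ℝ → ℝ) (hσ : ContDiff ℝ (⊤ : ℕ∞) σ) (hσc : HasCompactSupport σ) :
    ∃ C > (0:ℝ), ∃ δ₀ > (0:ℝ), ∀ δ : ℝ, 0 < δ → δ ≤ δ₀ →
      |(∫ t in (0:ℝ)..δ, ∫ ξ : ℝ,
          Real.exp (-(ξ ^ 2 + (h ξ) ^ 2) / (4 * t)) / (4 * Real.pi * t) *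
            (σ ξ * Real.sqrt (1 + (deriv h ξ) ^ 2)))
        - Real.sqrt δ * σ 0 / Real.sqrt Real.pi
        - δ ^ ((3:ℝ)/2) * (1 / (3 * Real.sqrt Real.pi)) *
            ((deriv (deriv h) 0) ^ 2 * σ 0 / 4 + deriv (deriv σ) 0)|
        ≤ C * δ ^ ((5:ℝ)/2) := by
  obtain ⟨hg, hg2⟩ := weight h σ hh h0' hσ
  set g : ℝ → ℝ := fun x => σ x * Real.sqrt (1 + (deriv h x)^2) with hgdef
  have hgc : HasCompactSupport g := hσc.mul_right
  have hg0 : g 0 = σ 0 := by simp [g, h0']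
  obtain ⟨C, hC, H⟩ := inner_bd h g hh h0 h0' hg hgc
  rw [hg2, hg0] at H
  set κ := deriv (deriv h) 0
  set σ2 := deriv (deriv σ) 0
  set T := κ^2 * σ 0 / 4 + σ2 with hT
  have hpi : 0 < Real.sqrt Real.pi := Real.sqrt_pos.mpr Real.pi_pos
  set I : ℝ → ℝ := fun t => ∫ ξ : ℝ, Real.exp (-(ξ ^ 2 + (h ξ) ^ 2) / (4 * t)) / (4 * Real.pi * t) *
            (σ ξ * Real.sqrt (1 + (deriv h ξ) ^ 2)) with hI
  set a := σ 0 / (2 * Real.sqrt Real.pi) with ha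
  set b := T / (2 * Real.sqrt Real.pi) with hb
  set c := 16 * C / (2 * Real.sqrt Real.pi) with hc
  have hc0 : 0 ≤ c := by positivity
  have hIb : ∀ t > 0, |I t - (a * t ^ (-(1/2):ℝ) + b * t ^ (1/2:ℝ))| ≤ c * t ^ (3/2:ℝ) := by
    intro t ht
    have h1 := H (1/(4*t)) (by positivity)
    have h2 : I t = 1/(4 * Real.pi * t) * ∫ x : ℝ, Real.exp (-(1/(4*t)) * (x^2 + (h x)^2)) * g x := by
      rw [← integral_const_mul]
      apply integral_congr_ae
      filter_upwards with x
      simp only [hgdef]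
      rw [show -(1/(4*t)) * (x^2 + (h x)^2) = -(x ^ 2 + (h x) ^ 2) / (4 * t) by ring]
      ring
    have hr0 : 0 < Real.sqrt t := Real.sqrt_pos.mpr ht
    have hr : Real.sqrt (Real.pi / (1/(4*t))) = 2 * Real.sqrt Real.pi * Real.sqrt t := by
      rw [show Real.pi / (1/(4*t)) = 2^2 * Real.pi * t by field_simp; try norm_num, Real.sqrt_mul (by positivity), Real.sqrt_mul (by positivity)]
      simp
    have e1 : t ^ (1/2:ℝ) = Real.sqrt t := (Real.sqrt_eq_rpow t).symm
    have e2 : t ^ (-(1/2):ℝ) = (Real.sqrt t)⁻¹ := by rw [Real.rpow_neg ht.le, e1]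
    have e3 : t ^ (3/2:ℝ) = t * Real.sqrt t := by
      rw [show (3/2:ℝ) = 1 + 1/2 by norm_num, Real.rpow_add ht, e1, Real.rpow_one]
    rw [e1, e2, e3, h2]
    rw [hr] at h1
    have hk : 0 < 1/(4 * Real.pi * t) := by have := Real.pi_pos; positivity
    have h3 := mul_le_mul_of_nonneg_left h1 hk.le
    rw [← abs_of_pos hk, ← abs_mul, abs_of_pos hk, mul_sub] at h3
    have hpp : Real.pi = Real.sqrt Real.pi ^ 2 := (Real.sq_sqrt Real.pi_pos.le).symm
    have htt : t = Real.sqrt t ^ 2 := (Real.sq_sqrt ht.le).symm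
    have q1 : 1 / (4 * Real.pi * t) * (2 * √Real.pi * √t * (σ 0 + ((σ2 + κ ^ 2 * σ 0) / 4 - 3 * κ ^ 2 * σ 0 / 16) / (1 / (4 * t))))
        = a * (√t)⁻¹ + b * √t := by
      rw [ha, hb, hT]
      clear_value κ σ2
      generalize σ 0 = σ0
      clear * - hpi hr0 hpp htt
      generalize Real.sqrt Real.pi = P at *
      generalize Real.sqrt t = r at *
      rw [hpp, htt]
      field_simp
      ring
    have q2 : 1 / (4 * Real.pi * t) * (C * (2 * √Real.pi * √t) / (1 / (4 * t)) ^ 2) = c * (t * √t) := by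
      rw [hc]
      clear * - hpi hr0 hpp htt
      generalize Real.sqrt Real.pi = P at *
      generalize Real.sqrt t = r at *
      rw [hpp, htt]
      field_simp
      try norm_num
      try ring
    rw [q1, q2] at h3
    exact h3
  have hmeas : StronglyMeasurable I := by
    apply StronglyMeasurable.integral_prod_right
    apply Measurable.stronglyMeasurable
    have m1 : Measurable h := hh.continuous.measurable
    have m2 : Measurable σ := hσ.continuous.measurable
    have m3 : Measurable (deriv h) := measurable_deriv h
    unfold Function.uncurry
    fun_prop
  refine ⟨c + 1, by positivity, 1, one_pos, fun δ hδ _ => ?_⟩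
  have i1 : IntervalIntegrable (fun t : ℝ => a * t ^ (-(1/2):ℝ)) volume 0 δ :=
    (intervalIntegral.intervalIntegrable_rpow' (by norm_num)).const_mul a
  have i2 : IntervalIntegrable (fun t : ℝ => b * t ^ (1/2:ℝ)) volume 0 δ :=
    (intervalIntegral.intervalIntegrable_rpow' (by norm_num)).const_mul b
  have i3 : IntervalIntegrable (fun t : ℝ => c * t ^ (3/2:ℝ)) volume 0 δ :=
    (intervalIntegral.intervalIntegrable_rpow' (by norm_num)).const_mul c
  have i12 := i1.add i2
  have iE : IntervalIntegrable (fun t => I t - (a * t ^ (-(1/2):ℝ) + b * t ^ (1/2:ℝ))) volume 0 δ := by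
    apply i3.mono_fun'
    · have m : Measurable I := hmeas.measurable
      apply Measurable.aestronglyMeasurable
      fun_prop
    · filter_upwards [ae_restrict_mem measurableSet_uIoc] with t ht
      rw [Set.uIoc_of_le hδ.le] at ht
      exact hIb t ht.1
  have iI : IntervalIntegrable I volume 0 δ := by
    have := iE.add i12
    refine this.congr ?_
    intro t _
    simp
  have hle := intervalIntegral.norm_integral_le_of_norm_le hδ.le (f := fun t => I t - (a * t ^ (-(1/2):ℝ) + b * t ^ (1/2:ℝ)))
    (g := fun t => c * t ^ (3/2:ℝ)) (μ := volume) (by filter_upwards with t ht using hIb t ht.1) i3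
  rw [intervalIntegral.integral_sub iI i12, intervalIntegral.integral_add i1 i2] at hle
  simp only [intervalIntegral.integral_const_mul] at hle
  rw [integral_rpow (by norm_num), integral_rpow (by norm_num), integral_rpow (by norm_num)] at hle
  norm_num at hle
  rw [Real.sqrt_eq_rpow δ]
  have hD : 0 ≤ δ ^ (5/2:ℝ) := by positivity
  refine le_trans (le_trans (le_of_eq ?_) hle) ?_
  · rw [ha, hb]
    congr 1
    field_simp
    ring
  · nlinarith
end

section
/- Let f : ℝ² → ℝ be smooth with compact support. Then there exists a constant C > 0 such that for all x ∈ ℝ² and all 0 < δ ≤ 1, | ∫_0^δ ∫_{ℝ²} exp(-‖x-y‖²/(4t))/(4πt) · f(y) dy dt - δ·f(x) - (δ²/2)·Δf(x) | ≤ C·δ³, where Δf = ∂²f/∂x₁² + ∂²f/∂x₂² is the Laplacian. That is, for target points away from any boundary, the local volume heat potential satisfies V_L[f](x) = δ f(x) + (δ²/2) Δf(x) + O(δ³). -/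
open MeasureTheory

/-- The Laplacian `Δf = ∂²f/∂x₁² + ∂²f/∂x₂²` of a function on the Euclidean plane. -/
noncomputable def planeLaplacian (f : EuclideanSpace ℝ (Fin 2) → ℝ)
    (x : EuclideanSpace ℝ (Fin 2)) : ℝ :=
  iteratedFDeriv ℝ 2 f x ![EuclideanSpace.single 0 1, EuclideanSpace.single 0 1] +
  iteratedFDeriv ℝ 2 f x ![EuclideanSpace.single 1 1, EuclideanSpace.single 1 1]

abbrev E2 := EuclideanSpace ℝ (Fin 2)

lemma iterDeriv_line (f : E2 → ℝ) (hf : ContDiff ℝ (⊤ : ℕ∞) f) (x z : E2) (n : ℕ) (s : ℝ) :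
    iteratedDeriv n (fun s : ℝ => f (x + s • z)) s = iteratedFDeriv ℝ n f (x + s • z) (fun _ => z) := by
  have h1 : (fun s : ℝ => f (x + s • z)) =
      (fun y => f (x + y)) ∘ (ContinuousLinearMap.toSpanSingleton ℝ z) := by
    ext s; simp
  have hg : ContDiff ℝ (⊤ : ℕ∞) (fun y => f (x + y)) := by fun_prop
  rw [iteratedDeriv_eq_iteratedFDeriv, h1,
    ContinuousLinearMap.iteratedFDeriv_comp_right _ hg _ (i := n) (by exact_mod_cast le_top)]
  rw [ContinuousMultilinearMap.compContinuousLinearMap_apply, iteratedFDeriv_comp_add_left]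
  simp

lemma taylor_line (f : E2 → ℝ) (hf : ContDiff ℝ (⊤ : ℕ∞) f) (M : ℝ)
    (hM : ∀ x, ‖iteratedFDeriv ℝ 4 f x‖ ≤ M) (x z : E2) :
    |f (x + z) - f x - iteratedFDeriv ℝ 1 f x (fun _ => z) - iteratedFDeriv ℝ 2 f x (fun _ => z) / 2
      - iteratedFDeriv ℝ 3 f x (fun _ => z) / 6| ≤ M * ‖z‖ ^ 4 := by
  set h : ℝ → ℝ := fun s => f (x + s • z) with hh
  have hc : ContDiff ℝ (⊤ : ℕ∞) h := by fun_prop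
  have key : ∀ n : ℕ, ∀ s ∈ Set.Icc (0:ℝ) 1, iteratedDerivWithin n h (Set.Icc 0 1) s
      = iteratedFDeriv ℝ n f (x + s • z) (fun _ => z) := by
    intro n s hs
    rw [iteratedDerivWithin_eq_iteratedDeriv (uniqueDiffOn_Icc one_pos)
      ((hc.of_le (by exact_mod_cast le_top)).contDiffAt) hs, iterDeriv_line f hf]
  have := taylor_mean_remainder_bound (f := h) (a := 0) (b := 1) (x := 1) (n := 3)
    (C := M * ‖z‖ ^ 4) zero_le_one ((contDiff_infty.1 hc 4).contDiffOn) (by simp)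
    (by
      intro y hy
      rw [key _ y hy]
      refine (ContinuousMultilinearMap.le_opNorm _ _).trans ?_
      simp only [Finset.prod_const, Finset.card_univ, Fintype.card_fin]
      gcongr
      exact hM _)
  simp only [taylorWithinEval_succ, taylor_within_zero_eval] at this
  rw [key _ 0 (by simp), key _ 0 (by simp), key _ 0 (by simp)] at this
  have hM0 : 0 ≤ M * ‖z‖^4 := mul_nonneg ((norm_nonneg _).trans (hM 0)) (by positivity)
  refine le_trans (le_of_eq ?_) (this.trans ?_)
  · rw [Real.norm_eq_abs]; congr 1
    simp [hh, Nat.factorial]; ring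
  · simp [Nat.factorial]; linarith

lemma taylor_symm (f : E2 → ℝ) (hf : ContDiff ℝ (⊤ : ℕ∞) f) (M : ℝ)
    (hM : ∀ x, ‖iteratedFDeriv ℝ 4 f x‖ ≤ M) (x z : E2) :
    |f (x + z) + f (x - z) - 2 * f x - iteratedFDeriv ℝ 2 f x (fun _ => z)| ≤ 2 * M * ‖z‖ ^ 4 := by
  have h1 := taylor_line f hf M hM x z
  have h2 := taylor_line f hf M hM x (-z)
  have hn : ∀ n : ℕ, iteratedFDeriv ℝ n f x (fun _ => -z) =
      (-1) ^ n * iteratedFDeriv ℝ n f x (fun _ => z) := by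
    intro n
    have := (iteratedFDeriv ℝ n f x).map_smul_univ (fun _ => (-1:ℝ)) (fun _ => z)
    simpa using this
  rw [hn, hn, hn, norm_neg, ← sub_eq_add_neg] at h2
  rw [abs_le] at *
  constructor <;> linarith [h1.1, h1.2, h2.1, h2.2]

noncomputable def ee (p : ℝ × ℝ) : E2 := !₂[p.1, p.2]

lemma ee_norm (p : ℝ × ℝ) : ‖ee p‖ ^ 2 = p.1 ^ 2 + p.2 ^ 2 := by
  rw [EuclideanSpace.norm_sq_eq]; simp [ee]

lemma ee_quad (f : E2 → ℝ) (x : E2) (p : ℝ × ℝ) :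
    iteratedFDeriv ℝ 2 f x (fun _ => ee p) =
      p.1 ^ 2 * iteratedFDeriv ℝ 2 f x ![EuclideanSpace.single 0 1, EuclideanSpace.single 0 1]
      + p.1 * p.2 * (iteratedFDeriv ℝ 2 f x ![EuclideanSpace.single 0 1, EuclideanSpace.single 1 1]
        + iteratedFDeriv ℝ 2 f x ![EuclideanSpace.single 1 1, EuclideanSpace.single 0 1])
      + p.2 ^ 2 * iteratedFDeriv ℝ 2 f x ![EuclideanSpace.single 1 1, EuclideanSpace.single 1 1] := by
  have he : ee p = p.1 • EuclideanSpace.single 0 1 + p.2 • EuclideanSpace.single 1 1 := by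
    ext i; fin_cases i <;> simp [ee]
  simp only [iteratedFDeriv_two_apply, he]
  simp
  ring

lemma ee_cont : Continuous ee := by unfold ee; fun_prop

lemma ee_mp : MeasurePreserving ee (volume : Measure (ℝ × ℝ)) volume := by
  have := (PiLp.volume_preserving_toLp (Fin 2)).comp ((volume_preserving_finTwoArrow ℝ).symm)
  have h : ee = WithLp.toLp 2 ∘ (MeasurableEquiv.finTwoArrow (α := ℝ)).symm := by
    ext p i; fin_cases i <;> rfl
  rw [h]; exact this

lemma ee_emb : MeasurableEmbedding ee := by
  have := (MeasurableEquiv.toLp 2 (Fin 2 → ℝ)).measurableEmbedding.comp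
     (MeasurableEquiv.finTwoArrow (α := ℝ)).symm.measurableEmbedding
  convert this using 1
  ext p : 1
  ext i; fin_cases i <;> rfl

open ProbabilityTheory in
noncomputable def gg : Measure (ℝ × ℝ) := (gaussianReal 0 1).prod (gaussianReal 0 1)

open ProbabilityTheory in
instance : IsProbabilityMeasure gg := by unfold gg; infer_instance

open ProbabilityTheory in
lemma gg_integral (g : E2 → ℝ) :
    ∫ p, g (ee p) ∂gg = ∫ w : E2, Real.exp (-‖w‖ ^ 2 / 2) / (2 * Real.pi) * g w := by
  rw [← ee_mp.integral_comp ee_emb]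
  unfold gg
  rw [gaussianReal_of_var_ne_zero _ one_ne_zero, prod_withDensity (by fun_prop) (by fun_prop)]
  rw [integral_withDensity_eq_integral_toReal_smul (by fun_prop) (by
    refine Filter.Eventually.of_forall fun p => ?_
    exact ENNReal.mul_lt_top (by simp [gaussianPDF]) (by simp [gaussianPDF]))]
  refine integral_congr_ae (Filter.Eventually.of_forall fun p => ?_)
  simp only [ENNReal.toReal_mul, toReal_gaussianPDF, smul_eq_mul, gaussianPDFReal, ee_norm]
  congr 1
  have h : √(2 * Real.pi) * √(2 * Real.pi) = 2 * Real.pi := Real.mul_self_sqrt (by positivity)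
  simp only [NNReal.coe_one, mul_one, sub_zero]
  rw [mul_mul_mul_comm, ← Real.exp_add, ← mul_inv, h,
    show -(p.1 ^ 2 + p.2 ^ 2) / 2 = -p.1^2/2 + -p.2^2/2 by ring]
  field_simp

lemma heat_eq (f : E2 → ℝ) (x : E2) (t : ℝ) (ht : 0 < t) :
    ∫ y, Real.exp (-‖x - y‖ ^ 2 / (4 * t)) / (4 * Real.pi * t) * f y
      = ∫ p, f (x - √(2 * t) • ee p) ∂gg := by
  rw [gg_integral (fun w => f (x - √(2 * t) • w))]
  have h1 := integral_sub_left_eq_self (μ := (volume : Measure E2)) (fun y => Real.exp (-‖y‖ ^ 2 / (4 * t)) / (4 * Real.pi * t) * f (x - y)) x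
  simp only [sub_sub_cancel] at h1
  rw [h1]
  have h2 := Measure.integral_comp_smul (μ := (volume : Measure E2)) (fun y => Real.exp (-‖y‖ ^ 2 / (4 * t)) / (4 * Real.pi * t) * f (x - y)) (√(2*t))
  have hs : √(2*t)^2 = 2 * t := Real.sq_sqrt (by positivity)
  have h3 : ∀ w : E2, Real.exp (-‖w‖ ^ 2 / 2) / (2 * Real.pi) * f (x - √(2 * t) • w)
     = (2 * t) * (Real.exp (-‖√(2 * t) • w‖ ^ 2 / (4 * t)) / (4 * Real.pi * t) * f (x - √(2 * t) • w)) := by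
    intro w
    rw [norm_smul, mul_pow, Real.norm_eq_abs, sq_abs, hs]
    rw [show -(2 * t * ‖w‖ ^ 2) / (4 * t) = -‖w‖ ^ 2 / 2 by field_simp; ring]
    field_simp; ring
  simp only [h3]
  rw [integral_const_mul, h2]
  simp only [finrank_euclideanSpace, Fintype.card_fin, hs, smul_eq_mul]
  rw [abs_of_pos (by positivity)]
  field_simp

open ProbabilityTheory in
lemma gg_neg : MeasurePreserving (fun p : ℝ × ℝ => -p) gg gg := by
  have h : MeasurePreserving (fun x : ℝ => -x) (gaussianReal 0 1) (gaussianReal 0 1) :=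
    ⟨by fun_prop, by simpa using gaussianReal_map_neg (μ := 0) (v := 1)⟩
  exact h.prod h

open ProbabilityTheory in
lemma pow_int (n : ℕ) : Integrable (fun x : ℝ => x ^ n) (gaussianReal 0 1) := by
  rcases Nat.eq_zero_or_pos n with rfl | hn
  · simp
  have := (memLp_id_gaussianReal (μ := 0) (v := 1) n).integrable_norm_pow (by omega)
  rw [← integrable_norm_iff (by fun_prop)]
  simpa using this

open ProbabilityTheory in
lemma m1 : ∫ x, x ∂(gaussianReal 0 1) = 0 := by simp

open ProbabilityTheory in
lemma m2 : ∫ x, x ^ 2 ∂(gaussianReal 0 1) = 1 := by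
  have := variance_fun_id_gaussianReal (μ := 0) (v := 1)
  rw [variance_eq_integral (by fun_prop)] at this
  simpa using this

open ProbabilityTheory in
lemma mono_int (m n : ℕ) : Integrable (fun p : ℝ × ℝ => p.1 ^ m * p.2 ^ n) gg :=
  (pow_int m).mul_prod (pow_int n)

open ProbabilityTheory in
lemma mono_val (m n : ℕ) : ∫ p : ℝ × ℝ, p.1 ^ m * p.2 ^ n ∂gg =
   (∫ x, x ^ m ∂(gaussianReal 0 1)) * ∫ x, x ^ n ∂(gaussianReal 0 1) :=
  integral_prod_mul _ _

lemma quad_int (f : E2 → ℝ) (x : E2) : Integrable (fun p => iteratedFDeriv ℝ 2 f x (fun _ => ee p)) gg := by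
  simp only [ee_quad]
  refine Integrable.add (Integrable.add ?_ ?_) ?_
  · simpa using (mono_int 2 0).mul_const _
  · simpa using (mono_int 1 1).mul_const _
  · simpa using (mono_int 0 2).mul_const _

lemma quad_val (f : E2 → ℝ) (x : E2) :
    ∫ p, iteratedFDeriv ℝ 2 f x (fun _ => ee p) ∂gg = planeLaplacian f x := by
  simp only [ee_quad]
  have a := (mono_int 2 0); have b := (mono_int 1 1); have c := mono_int 0 2
  have a1 := (mono_val 2 0); have b1 := (mono_val 1 1); have c1 := mono_val 0 2
  simp only [pow_zero, pow_one, mul_one, one_mul, m1, m2, zero_mul] at a b c a1 b1 c1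
  simp only [integral_const, probReal_univ, smul_eq_mul, mul_one] at a1 b1 c1
  rw [integral_add, integral_add (a.mul_const _) (b.mul_const _), integral_mul_const,
    integral_mul_const, integral_mul_const, a1, b1, c1, planeLaplacian]
  · ring
  · exact (a.mul_const _).add (b.mul_const _)
  · exact c.mul_const _

lemma norm4_int : Integrable (fun p => ‖ee p‖ ^ 4) gg := by
  have : ∀ p, ‖ee p‖ ^ 4 = p.1 ^ 4 * p.2 ^ 0 + 2 * (p.1 ^ 2 * p.2 ^ 2) + p.1 ^ 0 * p.2 ^ 4 := by
    intro p; rw [show ‖ee p‖ ^ 4 = (‖ee p‖ ^ 2) ^ 2 by ring, ee_norm]; ring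
  simp only [this]
  exact ((mono_int 4 0).add ((mono_int 2 2).const_mul 2)).add (mono_int 0 4)

lemma f_int (f : E2 → ℝ) (hf : Continuous f) (B : ℝ) (hB : ∀ x, ‖f x‖ ≤ B) (x : E2) (c : ℝ) :
    Integrable (fun p => f (x + c • ee p)) gg := by
  have := ee_cont
  refine Integrable.of_bound (C := B) (Continuous.aestronglyMeasurable (by fun_prop)) ?_
  exact Filter.Eventually.of_forall fun p => hB _

lemma point_bound (f : E2 → ℝ) (hf : ContDiff ℝ (⊤ : ℕ∞) f) (M B : ℝ)
    (hM : ∀ x, ‖iteratedFDeriv ℝ 4 f x‖ ≤ M) (hB : ∀ x, ‖f x‖ ≤ B) (x : E2) (t : ℝ) (ht : 0 < t) :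
    |(∫ p, f (x - √(2 * t) • ee p) ∂gg) - f x - t * planeLaplacian f x|
      ≤ 4 * M * (∫ p, ‖ee p‖ ^ 4 ∂gg) * t ^ 2 := by
  have hs : √(2*t)^2 = 2 * t := Real.sq_sqrt (by positivity)
  set c := √(2*t) with hc
  have i1 := f_int f hf.continuous B hB x c
  have i2 := f_int f hf.continuous B hB x (-c)
  simp only [neg_smul, ← sub_eq_add_neg] at i2
  have eqn : ∫ p, f (x + c • ee p) ∂gg = ∫ p, f (x - c • ee p) ∂gg := by
    rw [← gg_neg.integral_comp (MeasurableEquiv.neg (ℝ × ℝ)).measurableEmbedding]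
    congr 1; ext p
    have : ee (-p) = - ee p := by ext i; fin_cases i <;> simp [ee]
    rw [this, smul_neg, sub_eq_add_neg]
  have hq := quad_int f x
  have hD : ∀ p, iteratedFDeriv ℝ 2 f x (fun _ => c • ee p) =
      (2 * t) * iteratedFDeriv ℝ 2 f x (fun _ => ee p) := by
    intro p
    have := (iteratedFDeriv ℝ 2 f x).map_smul_univ (fun _ => c) (fun _ => ee p)
    rw [this]; simp [hs]
  have hI : ∫ p, (f (x + c • ee p) + f (x - c • ee p) - 2 * f x
      - (2 * t) * iteratedFDeriv ℝ 2 f x (fun _ => ee p)) ∂gg =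
      2 * ((∫ p, f (x - c • ee p) ∂gg) - f x - t * planeLaplacian f x) := by
    rw [integral_sub, integral_sub, integral_add i1 i2, integral_const_mul (2 * t), quad_val, eqn]
    · simp; ring
    · exact i1.add i2
    · exact integrable_const _
    · exact (i1.add i2).sub (integrable_const _)
    · exact hq.const_mul _
  have hb := norm_integral_le_of_norm_le (norm4_int.const_mul (2 * M * (2*t)^2))
    (f := fun p => f (x + c • ee p) + f (x - c • ee p) - 2 * f x
      - (2 * t) * iteratedFDeriv ℝ 2 f x (fun _ => ee p))
    (Filter.Eventually.of_forall fun p => by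
      have := taylor_symm f hf M hM x (c • ee p)
      rw [hD, norm_smul, mul_pow, Real.norm_eq_abs, show |c|^4 = (|c|^2)^2 by ring, sq_abs, hs] at this
      rw [Real.norm_eq_abs]
      linarith)
  rw [hI, integral_const_mul, Real.norm_eq_abs, abs_mul, abs_two] at hb
  linarith

/-- Interior asymptotics of the local volume heat potential:
`V_L[f](x) = δ f(x) + (δ²/2) Δf(x) + O(δ³)`, uniformly in `x`. -/
theorem local_volume_potential_interior_asymptotics
    (f : EuclideanSpace ℝ (Fin 2) → ℝ) (hf : ContDiff ℝ (⊤ : ℕ∞) f) (hfc : HasCompactSupport f) :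
    ∃ C > (0:ℝ), ∀ x : EuclideanSpace ℝ (Fin 2), ∀ δ : ℝ, 0 < δ → δ ≤ 1 →
      |(∫ t in (0:ℝ)..δ, ∫ y,
            Real.exp (-‖x - y‖ ^ 2 / (4 * t)) / (4 * Real.pi * t) * f y)
        - δ * f x - δ ^ 2 / 2 * planeLaplacian f x| ≤ C * δ ^ 3 := by
  obtain ⟨B, hB⟩ := hf.continuous.bounded_above_of_compact_support hfc
  obtain ⟨M, hM⟩ := ((contDiff_infty.1 hf 4).continuous_iteratedFDeriv (m := 4)
    le_rfl).bounded_above_of_compact_support (hfc.iteratedFDeriv (𝕜 := ℝ) 4)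
  have hM0 : 0 ≤ M := (norm_nonneg _).trans (hM 0)
  set K := 4 * M * (∫ p, ‖ee p‖ ^ 4 ∂gg) with hK
  have hK0 : 0 ≤ K := mul_nonneg (by positivity) (integral_nonneg fun p => by positivity)
  refine ⟨K + 1, by positivity, fun x δ hδ _ => ?_⟩
  have e1 : (∫ t in (0:ℝ)..δ, ∫ y,
            Real.exp (-‖x - y‖ ^ 2 / (4 * t)) / (4 * Real.pi * t) * f y) =
      ∫ t in (0:ℝ)..δ, ∫ p, f (x - √(2 * t) • ee p) ∂gg := by
    refine intervalIntegral.integral_congr_ae (Filter.Eventually.of_forall fun t ht => ?_)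
    rw [Set.uIoc_of_le hδ.le] at ht
    exact heat_eq f x t ht.1
  have hcont : Continuous fun t : ℝ => ∫ p, f (x - √(2 * t) • ee p) ∂gg := by
    have h1 := ee_cont
    have h2 := hf.continuous
    refine continuous_of_dominated (bound := fun _ => B) (fun t => Continuous.aestronglyMeasurable (by fun_prop))
      (fun t => Filter.Eventually.of_forall fun p => hB _) (integrable_const _)
      (Filter.Eventually.of_forall fun p => by fun_prop)
  have e2 : (∫ t in (0:ℝ)..δ, ∫ p, f (x - √(2 * t) • ee p) ∂gg) - δ * f x
      - δ ^ 2 / 2 * planeLaplacian f x =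
      ∫ t in (0:ℝ)..δ, ((∫ p, f (x - √(2 * t) • ee p) ∂gg) - f x - t * planeLaplacian f x) := by
    rw [intervalIntegral.integral_sub,
      intervalIntegral.integral_sub (hcont.intervalIntegrable _ _) (by simp),
      intervalIntegral.integral_mul_const]
    · simp
    · exact (hcont.sub continuous_const).intervalIntegrable _ _
    · exact Continuous.intervalIntegrable (by fun_prop) _ _
  rw [e1, e2]
  have := intervalIntegral.norm_integral_le_of_norm_le_const (a := 0) (b := δ) (C := K * δ ^ 2)
    (f := fun t => (∫ p, f (x - √(2 * t) • ee p) ∂gg) - f x - t * planeLaplacian f x)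
    (fun t ht => by
      rw [Set.uIoc_of_le hδ.le] at ht
      refine (point_bound f hf M B hM hB x t ht.1).trans ?_
      have := ht.1.le
      have := ht.2
      gcongr)
  rw [Real.norm_eq_abs, sub_zero, abs_of_pos hδ] at this
  have h3 : 0 < δ ^ 3 := by positivity
  nlinarith
end

section
/- Let δ > 0 and define the regularized kernel G_H[δ] : ℝ² \ {0} → ℝ by G_H[δ](x) = -(1/(2π)) log‖x‖ - (1/(4π)) ∫_1^∞ exp(-s‖x‖²/(4δ))/s ds. Then G_H[δ](x) converges, as x → 0 (x ≠ 0), to the finite limit (1/(4π))·(γ - log(4δ)), where γ is the Euler–Mascheroni constant; in particular the kernel splitting G = G_H[δ] + G_L[δ] of the 2D Laplace Green's function removes the logarithmic singularity at the origin from G_H[δ]. -/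
open MeasureTheory

lemma aux_int : IntegrableOn (fun t : ℝ => Real.log t * Real.exp (-t)) (Set.Ioi 0) := by
  have h := (mellin_hasDerivAt_of_isBigO_rpow (E := ℂ) (a := 2) (b := 0) (s := 1)
    (f := fun t : ℝ => ((Real.exp (-t) : ℝ) : ℂ)) ?_ ?_ (by norm_num) ?_ (by norm_num)).1
  · have h2 : IntegrableOn (fun t : ℝ => ((Real.log t * Real.exp (-t) : ℝ) : ℂ)) (Set.Ioi 0) := by
      refine (integrableOn_congr_fun ?_ measurableSet_Ioi).1 h
      intro t ht
      simp
    exact (MeasureTheory.Integrable.re h2)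
  · refine (Continuous.continuousOn ?_).locallyIntegrableOn measurableSet_Ioi
    fun_prop
  · rw [← Asymptotics.isBigO_norm_left]
    simp_rw [Complex.norm_real, Asymptotics.isBigO_norm_left]
    simpa only [neg_one_mul] using (isLittleO_exp_neg_mul_rpow_atTop zero_lt_one _).isBigO
  · simp_rw [neg_zero, Real.rpow_zero]
    refine Asymptotics.isBigO_const_of_tendsto (y := (1 : ℂ)) ?_ one_ne_zero
    have : Continuous (fun t : ℝ => ((Real.exp (-t) : ℝ) : ℂ)) := by fun_prop
    have h := this.tendsto 0
    simp only [neg_zero, Real.exp_zero, Complex.ofReal_one] at h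
    exact h.mono_left nhdsWithin_le_nhds

lemma aux_val : ∫ t in Set.Ioi (0:ℝ), Real.log t * Real.exp (-t)
    = -Real.eulerMascheroniConstant := by
  have h1 := Complex.hasDerivAt_GammaIntegral (s := 1) (by norm_num)
  have h2 : HasDerivAt Complex.GammaIntegral (-Real.eulerMascheroniConstant : ℂ) 1 := by
    refine Complex.hasDerivAt_Gamma_one.congr_of_eventuallyEq ?_
    have : IsOpen {s : ℂ | 0 < s.re} := isOpen_lt continuous_const Complex.continuous_re
    filter_upwards [this.mem_nhds (by simp : (1:ℂ) ∈ {s : ℂ | 0 < s.re})] with a ha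
    exact (Complex.Gamma_eq_integral ha).symm
  have h3 := h1.unique h2
  have h4 : ∫ t in Set.Ioi (0:ℝ), ((Real.log t * Real.exp (-t) : ℝ) : ℂ)
    = ((-Real.eulerMascheroniConstant : ℝ) : ℂ) := by
    push_cast
    rw [← h3]
    refine setIntegral_congr_fun measurableSet_Ioi fun t ht => ?_
    simp
  rw [integral_complex_ofReal] at h4
  exact_mod_cast h4

lemma aux_parts {z : ℝ} (hz : 0 < z) :
    ∫ s in Set.Ioi (1 : ℝ), Real.exp (-(s * z)) / s
      = -(Real.log z * Real.exp (-z)) + ∫ t in Set.Ioi z, Real.log t * Real.exp (-t) := by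
  have hsub : ∫ s in Set.Ioi (1 : ℝ), Real.exp (-(s * z)) / s
      = ∫ t in Set.Ioi z, Real.exp (-t) / t := by
    have h := integral_comp_mul_left_Ioi' (fun t : ℝ => Real.exp (-t) / t) 1 hz
    rw [mul_one] at h
    rw [← h, ← integral_smul]
    refine setIntegral_congr_fun measurableSet_Ioi fun t ht => ?_
    have : 0 < t := lt_trans one_pos ht
    simp only [smul_eq_mul]
    rw [mul_comm z t]
    field_simp
  have hi1 : IntegrableOn (fun t : ℝ => Real.log t * Real.exp (-t)) (Set.Ioi z) :=
    aux_int.mono_set (Set.Ioi_subset_Ioi hz.le)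
  have hi2 : IntegrableOn (fun t : ℝ => Real.exp (-t) / t) (Set.Ioi z) := by
    refine Integrable.mono' ((integrableOn_exp_neg_Ioi z).const_mul z⁻¹) ?_ ?_
    · exact (by fun_prop : Measurable fun t : ℝ => Real.exp (-t) / t).aestronglyMeasurable
    · refine (ae_restrict_iff' measurableSet_Ioi).2 (Filter.Eventually.of_forall fun t ht => ?_)
      have ht' : z < t := ht
      have : 0 < t := hz.trans ht'
      rw [Real.norm_of_nonneg (by positivity), div_eq_inv_mul]
      gcongr
  have hd := integral_Ioi_of_hasDerivAt_of_tendsto' (a := z) (m := 0)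
    (f := fun t => Real.log t * Real.exp (-t))
    (f' := fun t => Real.exp (-t) / t - Real.log t * Real.exp (-t)) ?_ (hi2.sub hi1) ?_
  · rw [integral_sub hi2 hi1] at hd
    rw [hsub]; linarith
  · intro t ht
    have : 0 < t := lt_of_lt_of_le hz ht
    have := (Real.hasDerivAt_log this.ne').mul ((hasDerivAt_neg t).exp)
    refine this.congr_deriv ?_
    ring
  · refine squeeze_zero' ?_ ?_ (Real.tendsto_pow_mul_exp_neg_atTop_nhds_zero 1)
    · filter_upwards [Filter.eventually_ge_atTop 1] with t ht
      exact mul_nonneg (Real.log_nonneg ht) (Real.exp_pos _).le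
    · filter_upwards [Filter.eventually_ge_atTop 1] with t ht
      rw [pow_one]
      gcongr
      exact Real.log_le_self (by linarith)

lemma aux_lim : Filter.Tendsto
    (fun z : ℝ => Real.log z + ∫ s in Set.Ioi (1 : ℝ), Real.exp (-(s * z)) / s)
    (nhdsWithin 0 (Set.Ioi 0)) (nhds (-Real.eulerMascheroniConstant)) := by
  have h1 : Filter.Tendsto (fun z : ℝ => ∫ t in Set.Ioi z, Real.log t * Real.exp (-t))
      (nhdsWithin 0 (Set.Ioi 0)) (nhds (-Real.eulerMascheroniConstant)) := by
    have hc : AECover (volume.restrict (Set.Ioi (0:ℝ))) (nhdsWithin (0:ℝ) (Set.Ioi 0))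
        (fun z => Set.Ioi z) := aecover_Ioi_of_Ioi nhdsWithin_le_nhds
    have := hc.integral_tendsto_of_countably_generated aux_int
    rw [aux_val] at this
    refine this.congr' ?_
    filter_upwards [self_mem_nhdsWithin] with z hz
    rw [Measure.restrict_restrict measurableSet_Ioi,
      Set.inter_eq_left.2 (Set.Ioi_subset_Ioi (le_of_lt hz))]
  have h2 : Filter.Tendsto (fun z : ℝ => (1 - Real.exp (-z)) * Real.log z)
      (nhdsWithin 0 (Set.Ioi 0)) (nhds 0) := by
    have h := (Real.continuous_mul_log.tendsto 0).mono_left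
      (nhdsWithin_le_nhds (s := Set.Ioi 0))
    rw [zero_mul] at h
    refine squeeze_zero_norm' ?_ (by simpa using h.abs)
    filter_upwards [self_mem_nhdsWithin] with z hz
    have hz' : 0 < z := hz
    rw [Real.norm_eq_abs, abs_mul, abs_of_pos hz']
    gcongr
    rw [abs_of_nonneg]
    · linarith [Real.add_one_le_exp (-z)]
    · have : Real.exp (-z) ≤ 1 := Real.exp_le_one_iff.2 (by linarith)
      linarith
  have h3 := h2.add h1
  rw [zero_add] at h3
  refine h3.congr' ?_
  filter_upwards [self_mem_nhdsWithin] with z hz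
  rw [aux_parts hz]
  ring


/-- The regularized (history) kernel of the Ewald splitting of the 2D Laplace Green's
function, `G_H[δ](x) = -(1/(2π)) log‖x‖ - (1/(4π)) E₁(‖x‖²/(4δ))`, tends to the finite
limit `(1/(4π))(γ - log(4δ))` as `x → 0` (`x ≠ 0`), where `γ` is the Euler–Mascheroni
constant: the splitting removes the logarithmic singularity at the origin. -/
theorem regularized_kernel_limit_at_zero (δ : ℝ) (hδ : 0 < δ) :
    Filter.Tendsto
      (fun x : EuclideanSpace ℝ (Fin 2) =>
        -(1 / (2 * Real.pi)) * Real.log ‖x‖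
          - (1 / (4 * Real.pi)) *
              ∫ s in Set.Ioi (1 : ℝ), Real.exp (-(s * ‖x‖ ^ 2) / (4 * δ)) / s)
      (nhdsWithin 0 {0}ᶜ)
      (nhds ((1 / (4 * Real.pi)) *
        (Real.eulerMascheroniConstant - Real.log (4 * δ)))) := by
  have hz : Filter.Tendsto (fun x : EuclideanSpace ℝ (Fin 2) => ‖x‖ ^ 2 / (4 * δ))
      (nhdsWithin 0 {0}ᶜ) (nhdsWithin 0 (Set.Ioi 0)) := by
    refine tendsto_nhdsWithin_iff.2 ⟨?_, ?_⟩
    · have : Continuous (fun x : EuclideanSpace ℝ (Fin 2) => ‖x‖ ^ 2 / (4 * δ)) := by fun_prop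
      have h := this.tendsto 0
      simp only [norm_zero, ne_eq, OfNat.ofNat_ne_zero, not_false_eq_true, zero_pow,
        zero_div] at h
      exact h.mono_left nhdsWithin_le_nhds
    · filter_upwards [self_mem_nhdsWithin] with x hx
      have : 0 < ‖x‖ := norm_pos_iff.2 hx
      exact Set.mem_Ioi.2 (by positivity)
  have h := ((aux_lim.comp hz).add_const (Real.log (4 * δ))).const_mul (-(1 / (4 * Real.pi)))
  have e : -(1 / (4 * Real.pi)) * (-Real.eulerMascheroniConstant + Real.log (4 * δ))
      = (1 / (4 * Real.pi)) * (Real.eulerMascheroniConstant - Real.log (4 * δ)) := by ring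
  rw [e] at h
  refine h.congr' ?_
  filter_upwards [self_mem_nhdsWithin] with x hx
  have hx' : 0 < ‖x‖ := norm_pos_iff.2 hx
  simp only [Function.comp]
  rw [Real.log_div (by positivity) (by positivity), Real.log_pow]
  have e2 : ∀ s : ℝ, -(s * (‖x‖ ^ 2 / (4 * δ))) = -(s * ‖x‖ ^ 2) / (4 * δ) := by
    intro s; ring
  simp only [e2]
  push_cast
  ring
end
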